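/- Let u ≤_k w and x ≤_l z, and suppose that wu⁻¹ is shape equivalent to zx⁻¹. Then the intervals [u,w]_k = {v : u ≤_k v ≤_k w} in the k-Bruhat order and [x,z]_l = {v : x ≤_l v ≤_l z} in the l-Bruhat order are isomorphic as partially ordered sets. -/

import Mathlib

/-- A permutation of the positive integers belongs to `S_∞` when it moves only
finitely many points. -/
def FinSupp (w : Equiv.Perm ℕ+) : Prop := {x : ℕ+ | w x ≠ x}.Finite

/-- The length `ℓ(w)` of a permutation: its number of inversions, i.e. of pairs
`i < j` with `w i > w j`. -/
noncomputable def len (w : Equiv.Perm ℕ+) : ℕ :=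
  Set.ncard {p : ℕ+ × ℕ+ | p.1 < p.2 ∧ w p.2 < w p.1}

/-- Covering relation of the `k`-Bruhat order: `u ⋖_k u(a,b)` for `a ≤ k < b`
with `ℓ(u(a,b)) = ℓ(u) + 1`.  Here `u(a,b) = u * (swap a b)`. -/
def kBruhatCov (k : ℕ+) (u w : Equiv.Perm ℕ+) : Prop :=
  ∃ a b : ℕ+, a ≤ k ∧ k < b ∧ w = u * Equiv.swap a b ∧ len w = len u + 1

/-- The `k`-Bruhat order `u ≤_k w`: a chain of `k`-Bruhat covers from `u` to `w`
(or `u = w`). -/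
def kBruhat (k : ℕ+) : Equiv.Perm ℕ+ → Equiv.Perm ℕ+ → Prop :=
  Relation.ReflTransGen (kBruhatCov k)
/-- Permutations `ζ` and `η` are shape equivalent if there are sets
`P = {p_1 < ⋯ < p_n}` and `Q = {q_1 < ⋯ < q_n}` such that `ζ` fixes everything
outside `P`, `η` fixes everything outside `Q`, and `ζ(p_i) = p_j ↔ η(q_i) = q_j`. -/
def ShapeEquiv (ζ η : Equiv.Perm ℕ+) : Prop :=
  ∃ (n : ℕ) (p q : Fin n → ℕ+), StrictMono p ∧ StrictMono q ∧
    (∀ x : ℕ+, x ∉ Set.range p → ζ x = x) ∧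
    (∀ x : ℕ+, x ∉ Set.range q → η x = x) ∧
    (∀ i j : Fin n, ζ (p i) = p j ↔ η (q i) = q j)

open Equiv

/-- The set of inversions of a permutation. -/
def inversions (w : Perm ℕ+) : Set (ℕ+ × ℕ+) :=
  {p | p.1 < p.2 ∧ w p.2 < w p.1}

/-- The intrinsic description of the `k`-Bruhat order. -/
structure Dominates (k : ℕ+) (u w : Perm ℕ+) : Prop where
  le_low : ∀ a ≤ k, u a ≤ w a
  le_high : ∀ b, k < b → w b ≤ u b
  lt_low : ∀ a b, a < b → b ≤ k → u a < u b → w a < w b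
  lt_high : ∀ a b, a < b → k < a → u a < u b → w a < w b

/-- The order relation on permutations of a linear order describing the intervals of all
`k`-Bruhat orders at once. -/
structure Below {α : Type*} [LinearOrder α] (η ζ : Perm α) : Prop where
  between : ∀ a, (a ≤ η a ∧ η a ≤ ζ a) ∨ (ζ a ≤ η a ∧ η a ≤ a)
  lt_up : ∀ a b, a < b → ζ a < ζ b → a < ζ a → b < ζ b → η a < η b
  lt_down : ∀ a b, a < b → ζ a < ζ b → ζ a < a → ζ b < b → η a < η b

section Length

/-- Apply the transposition `(a, b)` to both entries of a pair, unless this reverses their order. -/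
def swapPair (a b : ℕ+) (p : ℕ+ × ℕ+) : ℕ+ × ℕ+ :=
  if swap a b p.1 < swap a b p.2 then (swap a b p.1, swap a b p.2) else p

lemma swapPair_swapPair (a b : ℕ+) {p : ℕ+ × ℕ+} (hp : p.1 < p.2) :
    swapPair a b (swapPair a b p) = p := by
  unfold swapPair
  by_cases h : swap a b p.1 < swap a b p.2 <;> simp [h, hp]

lemma injOn_swapPair (a b : ℕ+) (u : Perm ℕ+) : Set.InjOn (swapPair a b) (inversions u) := by
  intro p hp q hq h
  rw [← swapPair_swapPair a b hp.1, h, swapPair_swapPair a b hq.1]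

lemma eq_and_le_of_swap_le {a b i j : ℕ+} (hab : a < b) (hij : i < j)
    (h : swap a b j ≤ swap a b i) : (i = a ∧ j ≤ b) ∨ (j = b ∧ a ≤ i) := by
  rw [swap_apply_def, swap_apply_def] at h
  split_ifs at h <;> grind

lemma swapPair_mem_inversions {a b : ℕ+} {u : Perm ℕ+} (hab : a < b) (hu : u a < u b)
    {p : ℕ+ × ℕ+} (hp : p ∈ inversions u) : swapPair a b p ∈ inversions (u * swap a b) := by
  obtain ⟨i, j⟩ := p
  obtain ⟨hij, hinv⟩ := hp
  unfold swapPair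
  split_ifs with h
  · exact ⟨h, by simpa using hinv⟩
  · refine ⟨hij, ?_⟩
    rcases eq_and_le_of_swap_le hab hij (not_lt.1 h) with ⟨rfl, hjb⟩ | ⟨rfl, hai⟩
    · have hjb' : j ≠ b := fun hjb => hinv.not_gt (hjb ▸ hu)
      simpa [swap_apply_of_ne_of_ne hij.ne' hjb'] using hinv.trans hu
    · have hai' : i ≠ a := fun hai => hinv.not_gt (hai ▸ hu)
      simpa [swap_apply_of_ne_of_ne hai' hij.ne] using hu.trans hinv

lemma notMem_image_swapPair {a b c : ℕ+} {u : Perm ℕ+} (hu : u a < u c) (hac : a < c)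
    (hcb : c ≤ b) : (a, c) ∉ swapPair a b '' inversions u := by
  rintro ⟨p, hp, h⟩
  have hp' : p = swapPair a b (a, c) := by rw [← h, swapPair_swapPair a b hp.1]
  have hac' : swapPair a b (a, c) = (a, c) := by
    unfold swapPair
    refine if_neg ?_
    rcases hcb.eq_or_lt with rfl | hcb
    · simpa using hac.le
    · simpa [swap_apply_of_ne_of_ne hac.ne' hcb.ne] using hcb.le
  rw [hp', hac'] at hp
  exact hp.2.not_gt hu

lemma insert_subset_inversions {a b : ℕ+} {u : Perm ℕ+} (hab : a < b) (hu : u a < u b) :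
    insert (a, b) (swapPair a b '' inversions u) ⊆ inversions (u * swap a b) := by
  refine Set.insert_subset ⟨hab, by simpa using hu⟩ ?_
  rintro _ ⟨p, hp, rfl⟩
  exact swapPair_mem_inversions hab hu hp

lemma inversions_mul_swap {a b : ℕ+} {u : Perm ℕ+} (hab : a < b) (hu : u a < u b)
    (hbetween : ∀ c, a < c → c < b → u a < u c → u b < u c) :
    inversions (u * swap a b) = insert (a, b) (swapPair a b '' inversions u) := by
  refine Set.Subset.antisymm ?_ (insert_subset_inversions hab hu)
  rintro ⟨i, j⟩ ⟨hij, hinv⟩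
  rw [Set.mem_insert_iff, or_iff_not_imp_left]
  intro hne
  refine ⟨swapPair a b (i, j), ?_, swapPair_swapPair a b hij⟩
  unfold swapPair
  split_ifs with h
  · exact ⟨h, hinv⟩
  · refine ⟨hij, ?_⟩
    simp only [Perm.mul_apply] at hinv ⊢
    rcases eq_and_le_of_swap_le hab hij (not_lt.1 h) with ⟨rfl, hjb⟩ | ⟨rfl, hai⟩
    · have hjb' : j ≠ b := fun hjb => hne (hjb ▸ rfl)
      rw [swap_apply_left, swap_apply_of_ne_of_ne hij.ne' hjb'] at hinv
      by_contra! hcon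
      exact (hbetween j hij (lt_of_le_of_ne hjb hjb')
        (lt_of_le_of_ne hcon (u.injective.ne hij.ne))).not_gt hinv
    · have hai' : i ≠ a := fun hai => hne (hai ▸ rfl)
      rw [swap_apply_right, swap_apply_of_ne_of_ne hai' hij.ne] at hinv
      exact hbetween i (lt_of_le_of_ne hai hai'.symm) hij hinv

lemma ncard_insert_image_swapPair {a b : ℕ+} {u : Perm ℕ+} (hfin : (inversions u).Finite)
    (hab : a < b) (hu : u a < u b) :
    (insert (a, b) (swapPair a b '' inversions u)).ncard = len u + 1 := by
  rw [Set.ncard_insert_of_notMem (notMem_image_swapPair hu hab le_rfl) (hfin.image _),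
    (injOn_swapPair a b u).ncard_image]
  rfl

lemma finite_inversions_of_len_pos {u : Perm ℕ+} (h : 0 < len u) : (inversions u).Finite :=
  Set.finite_of_ncard_pos h

lemma len_mul_swap {a b : ℕ+} {u : Perm ℕ+} (hfin : (inversions u).Finite)
    (hab : a < b) (hu : u a < u b) (hbetween : ∀ c, a < c → c < b → u a < u c → u b < u c) :
    len (u * swap a b) = len u + 1 := by
  rw [← ncard_insert_image_swapPair hfin hab hu, ← inversions_mul_swap hab hu hbetween]
  rfl

lemma lt_of_len_mul_swap {a b : ℕ+} {u : Perm ℕ+} (hfin : (inversions u).Finite) (hab : a < b)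
    (hlen : len (u * swap a b) = len u + 1) : u a < u b := by
  by_contra hcon
  have hlt : (u * swap a b) a < (u * swap a b) b := by
    simpa using lt_of_le_of_ne (not_lt.1 hcon) (u.injective.ne hab.ne')
  have hsub := insert_subset_inversions hab hlt
  rw [mul_assoc, swap_mul_self, mul_one] at hsub
  have hle : _ ≤ len u := Set.ncard_le_ncard hsub hfin
  rw [ncard_insert_image_swapPair (finite_inversions_of_len_pos (by omega)) hab hlt] at hle
  omega

lemma lt_of_between_of_len_mul_swap {a b c : ℕ+} {u : Perm ℕ+} (hfin : (inversions u).Finite)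
    (hlen : len (u * swap a b) = len u + 1) (hac : a < c) (hcb : c < b) (huc : u a < u c) :
    u b < u c := by
  have hab := hac.trans hcb
  have hu := lt_of_len_mul_swap hfin hab hlen
  by_contra hcon
  have hcb' : u c < u b := lt_of_le_of_ne (not_lt.1 hcon) (u.injective.ne hcb.ne)
  have hmem : (a, c) ∈ inversions (u * swap a b) :=
    ⟨hac, by simpa [swap_apply_of_ne_of_ne hac.ne' hcb.ne] using hcb'⟩
  have hnot : (a, c) ∉ insert (a, b) (swapPair a b '' inversions u) := by
    rw [Set.mem_insert_iff, not_or]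
    exact ⟨fun h => hcb.ne (Prod.ext_iff.1 h).2, notMem_image_swapPair huc hac hcb.le⟩
  have hlt : _ < len (u * swap a b) := Set.ncard_lt_ncard
    ((insert_subset_inversions hab hu).ssubset_of_mem_notMem hmem hnot)
    (finite_inversions_of_len_pos (by omega))
  rw [ncard_insert_image_swapPair hfin hab hu] at hlt
  omega

lemma finite_inversions {u : Perm ℕ+} (hu : FinSupp u) : (inversions u).Finite := by
  obtain ⟨N, hN⟩ := hu.bddAbove
  have hfix : ∀ x, N < x → u x = x := fun x hx => by
    by_contra h
    exact (hN h).not_gt hx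
  refine ((Set.finite_Iic N).prod (Set.finite_Iic N)).subset ?_
  rintro ⟨i, j⟩ ⟨hij, hinv⟩
  simp only at hij hinv
  have hj : j ≤ N := by
    by_contra! h
    rw [hfix j h] at hinv
    have := u.injective (hfix (u i) (h.trans hinv))
    order
  exact ⟨hij.le.trans hj, hj⟩

end Length

section Criterion

variable {k : ℕ+} {u v w : Perm ℕ+}

lemma Dominates.refl (k : ℕ+) (u : Perm ℕ+) : Dominates k u u :=
  ⟨fun _ _ => le_rfl, fun _ _ => le_rfl, fun _ _ _ _ h => h, fun _ _ _ _ h => h⟩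

lemma Dominates.trans (h₁ : Dominates k u v) (h₂ : Dominates k v w) : Dominates k u w where
  le_low a ha := (h₁.le_low a ha).trans (h₂.le_low a ha)
  le_high b hb := (h₂.le_high b hb).trans (h₁.le_high b hb)
  lt_low a b hab hb h := h₂.lt_low a b hab hb (h₁.lt_low a b hab hb h)
  lt_high a b hab ha h := h₂.lt_high a b hab ha (h₁.lt_high a b hab ha h)

lemma kBruhatCov.dominates (hfin : (inversions u).Finite) (h : kBruhatCov k u v) :
    Dominates k u v := by
  obtain ⟨a, b, ha, hb, rfl, hlen⟩ := h
  have hab := ha.trans_lt hb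
  have hu := lt_of_len_mul_swap hfin hab hlen
  refine ⟨fun c hc => ?_, fun c hc => ?_, fun c d hcd hd h => ?_, fun c d hcd hc h => ?_⟩ <;>
    simp only [Perm.mul_apply]
  · rcases eq_or_ne c a with rfl | hca
    · simpa using hu.le
    · rw [swap_apply_of_ne_of_ne hca (by order)]
  · rcases eq_or_ne c b with rfl | hcb
    · simpa using hu.le
    · rw [swap_apply_of_ne_of_ne (by order) hcb]
  · rw [swap_apply_def, swap_apply_def]
    have hcb : c ≠ b := by order
    have hdb : d ≠ b := by order
    simp only [hcb, hdb, if_false]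
    split_ifs with h1 h2 h2
    · order
    · subst h1
      exact lt_of_between_of_len_mul_swap hfin hlen hcd (by order) h
    · subst h2
      order
    · exact h
  · rw [swap_apply_def, swap_apply_def]
    have hca : c ≠ a := by order
    have hda : d ≠ a := by order
    simp only [hca, hda, if_false]
    split_ifs with h1 h2 h2
    · order
    · subst h1
      order
    · subst h2
      by_contra! hcon
      have hac : u a < u c := lt_of_le_of_ne hcon (u.injective.ne hca.symm)
      exact (lt_of_between_of_len_mul_swap hfin hlen (by order) hcd hac).not_gt h
    · exact h

lemma kBruhat.dominates_and_finite (hfin : (inversions u).Finite) (h : kBruhat k u w) :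
    Dominates k u w ∧ (inversions w).Finite := by
  induction h with
  | refl => exact ⟨Dominates.refl k u, hfin⟩
  | tail _ hcov ih =>
    refine ⟨ih.1.trans (hcov.dominates ih.2), ?_⟩
    obtain ⟨a, b, -, -, -, hlen⟩ := hcov
    exact finite_inversions_of_len_pos (by omega)

lemma Dominates.eq_of_forall_low (h : Dominates k u w) (heq : ∀ a ≤ k, u a = w a) : u = w := by
  have hle : ∀ b, w b ≤ u b := fun b => by
    rcases le_or_gt b k with hb | hb
    · exact (heq b hb).ge
    · exact h.le_high b hb
  have key : ∀ n b, u b = n → w b = n := by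
    intro n
    induction n using WellFoundedLT.induction with
    | ind n ih =>
      rintro b rfl
      by_contra hne
      have hlt := lt_of_le_of_ne (hle b) hne
      have := ih (w b) hlt (u.symm (w b)) (by simp)
      rw [EmbeddingLike.apply_eq_iff_eq] at this
      rw [symm_apply_eq] at this
      exact hlt.ne this
  exact Equiv.ext fun b => (key _ b rfl).symm

/-- If position `a` is chosen with `u a` maximal among the low positions that have to grow, then
some high value in `(u a, w a]` has to drop to `u a` or below. -/
lemma Dominates.exists_high (h : Dominates k u w) {a : ℕ+} (hlt : u a < w a)
    (hmax : ∀ c ≤ k, u a < u c → w c = u c) : ∃ b, u a < u b ∧ u b ≤ w a ∧ w b ≤ u a := by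
  by_contra! hcon
  have hmaps : ∀ x ∈ Finset.Ioc (u a) (w a), w (u.symm x) ∈ Finset.Ioc (u a) (w a) := by
    intro x hx
    obtain ⟨h1, h2⟩ := Finset.mem_Ioc.1 hx
    refine Finset.mem_Ioc.2 ⟨hcon _ (by simpa using h1) (by simpa using h2), ?_⟩
    rcases le_or_gt (u.symm x) k with hk | hk
    · rw [hmax _ hk (by simpa using h1)]
      simpa using h2
    · exact (h.le_high _ hk).trans (by simpa using h2)
  have hsurj := Finset.surj_on_of_inj_on_of_card_le (s := Finset.Ioc (u a) (w a))
    (t := Finset.Ioc (u a) (w a)) (fun x _ => w (u.symm x)) hmaps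
    (fun x y _ _ hxy => by simpa using hxy) le_rfl
  obtain ⟨x, hx, hxw⟩ := hsurj (w a) (Finset.mem_Ioc.2 ⟨hlt, le_rfl⟩)
  have : x = u a := by
    have := w.injective hxw
    rw [this]
    simp
  rw [this] at hx
  simp at hx

lemma Dominates.exists_cov (hfin : (inversions u).Finite) (h : Dominates k u w) (hne : u ≠ w) :
    ∃ a b : ℕ+, a ≤ k ∧ k < b ∧ u a < u b ∧ len (u * swap a b) = len u + 1 ∧
      Dominates k (u * swap a b) w := by
  have hS : ((Finset.Iic k).filter fun a => u a < w a).Nonempty := by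
    by_contra hemp
    rw [Finset.not_nonempty_iff_eq_empty, Finset.filter_eq_empty_iff] at hemp
    exact hne (h.eq_of_forall_low fun a ha =>
      le_antisymm (h.le_low a ha) (not_lt.1 (hemp (Finset.mem_Iic.2 ha))))
  obtain ⟨a, haS, hamax⟩ := Finset.exists_max_image _ u hS
  obtain ⟨ha, hlt⟩ := Finset.mem_filter.1 haS
  rw [Finset.mem_Iic] at ha
  have hmax : ∀ c ≤ k, u a < u c → w c = u c := fun c hc hac => by
    by_contra hne
    exact (hamax c (Finset.mem_filter.2 ⟨Finset.mem_Iic.2 hc,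
      lt_of_le_of_ne (h.le_low c hc) (Ne.symm hne)⟩)).not_gt hac
  obtain ⟨b, ⟨hub, hbw, hwb⟩, hbmin⟩ :=
    exists_minimalFor_of_wellFoundedLT _ u (h.exists_high hlt hmax)
  have hb : k < b := by
    by_contra! hb
    exact (h.le_low b hb).not_gt (hwb.trans_lt hub)
  have hab := ha.trans_lt hb
  have hmin : ∀ c, u a < u c → u c < u b → u a < w c := fun c h1 h2 => by
    by_contra! hcon
    exact (hbmin (j := c) ⟨h1, h2.le.trans hbw, hcon⟩ h2.le).not_gt h2
  refine ⟨a, b, ha, hb, hub, len_mul_swap hfin hab hub ?_, ?_⟩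
  · intro c hac hcb huc
    by_contra! hcon
    have hcb' : u c < u b := lt_of_le_of_ne hcon (u.injective.ne hcb.ne)
    rcases le_or_gt c k with hc | hc
    · have h1 := h.lt_low a c hac hc huc
      rw [hmax c hc huc] at h1
      order
    · have h1 := h.lt_high c b hcb hc hcb'
      have h2 := hmin c huc hcb'
      order
  refine ⟨fun c hc => ?_, fun c hc => ?_, fun c d hcd hd => ?_, fun c d hcd hc => ?_⟩ <;>
    simp only [Perm.mul_apply]
  · rcases eq_or_ne c a with rfl | hca
    · simpa using hbw
    · rw [swap_apply_of_ne_of_ne hca (by order)]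
      exact h.le_low c hc
  · rcases eq_or_ne c b with rfl | hcb
    · simpa using hwb
    · rw [swap_apply_of_ne_of_ne (by order) hcb]
      exact h.le_high c hc
  · rw [swap_apply_def, swap_apply_def]
    have hcb : c ≠ b := by order
    have hdb : d ≠ b := by order
    simp only [hcb, hdb, if_false]
    split_ifs with h1 h2 h2 <;> intro hlt'
    · order
    · subst h1
      exact h.lt_low _ _ hcd hd (hub.trans hlt')
    · subst h2
      rcases lt_or_gt_of_ne (u.injective.ne h1) with h3 | h3
      · exact h.lt_low _ _ hcd hd h3
      · rw [hmax c (hcd.le.trans hd) h3]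
        order
    · exact h.lt_low _ _ hcd hd hlt'
  · rw [swap_apply_def, swap_apply_def]
    have hca : c ≠ a := by order
    have hda : d ≠ a := by order
    simp only [hca, hda, if_false]
    split_ifs with h1 h2 h2 <;> intro hlt'
    · order
    · subst h1
      rcases lt_or_gt_of_ne (u.injective.ne h2) with h3 | h3
      · exact hwb.trans_lt (hmin d hlt' h3)
      · exact h.lt_high _ _ hcd hc h3
    · subst h2
      exact h.lt_high _ _ hcd hc (hlt'.trans hub)
    · exact h.lt_high _ _ hcd hc hlt'

lemma kBruhat_of_dominates {u w : Perm ℕ+} (hfin : (inversions u).Finite) (h : Dominates k u w) : kBruhat k u w := by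
  by_cases hne : u = w
  · rw [hne]
    exact Relation.ReflTransGen.refl
  obtain ⟨a, b, ha, hb, hub, hlen, hdom⟩ := h.exists_cov hfin hne
  have hdec : ∑ c ∈ Finset.Iic k, ((w c : ℕ) - ((u * swap a b) c : ℕ)) <
      ∑ c ∈ Finset.Iic k, ((w c : ℕ) - (u c : ℕ)) := by
    refine Finset.sum_lt_sum (fun c hc => ?_) ⟨a, Finset.mem_Iic.2 ha, ?_⟩
    · rcases eq_or_ne c a with rfl | hca
      · have : (u c : ℕ) < u b := hub
        simp only [Perm.mul_apply, swap_apply_left]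
        omega
      · have hcb : c ≠ b := ((Finset.mem_Iic.1 hc).trans_lt hb).ne
        simp [swap_apply_of_ne_of_ne hca hcb]
    · have h1 : (u a : ℕ) < u b := hub
      have h2 := hdom.le_low a ha
      simp only [Perm.mul_apply, swap_apply_left] at h2 ⊢
      have h3 : (u b : ℕ) ≤ w a := h2
      omega
  exact Relation.ReflTransGen.head ⟨a, b, ha, hb, rfl, hlen⟩
    (kBruhat_of_dominates (finite_inversions_of_len_pos (by omega)) hdom)
termination_by ∑ c ∈ Finset.Iic k, ((w c : ℕ) - (u c : ℕ))

lemma kBruhat_iff_dominates (hfin : (inversions u).Finite) :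
    kBruhat k u w ↔ Dominates k u w :=
  ⟨fun h => (h.dominates_and_finite hfin).1, kBruhat_of_dominates hfin⟩

/-- Whether a permutation lies in an interval of the `k`-Bruhat order depends only on the
associated left quotients. -/
lemma Dominates.dominates_and_dominates_iff {η ζ : Perm ℕ+} (h : Dominates k u (ζ * u)) :
    Dominates k u (η * u) ∧ Dominates k (η * u) (ζ * u) ↔ Below η ζ := by
  have hup : ∀ c, u c < ζ (u c) → c ≤ k := fun c hc => by
    by_contra! hk
    exact (h.le_high c hk).not_gt hc
  have hdown : ∀ c, ζ (u c) < u c → k < c := fun c hc => by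
    by_contra! hk
    exact (h.le_low c hk).not_gt hc
  constructor
  · rintro ⟨h₁, h₂⟩
    refine ⟨fun α => ?_, fun α β hαβ hζ hα hβ => ?_, fun α β hαβ hζ hα hβ => ?_⟩
    · obtain ⟨c, rfl⟩ := u.surjective α
      rcases le_or_gt c k with hc | hc
      · exact .inl ⟨h₁.le_low c hc, h₂.le_low c hc⟩
      · exact .inr ⟨h₂.le_high c hc, h₁.le_high c hc⟩
    all_goals
      obtain ⟨c, rfl⟩ := u.surjective α
      obtain ⟨d, rfl⟩ := u.surjective β
    · rcases lt_trichotomy c d with hcd | rfl | hcd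
      · exact h₁.lt_low c d hcd (hup d hβ) hαβ
      · exact absurd hαβ (lt_irrefl _)
      · by_contra! hcon
        have hne : η (u d) < η (u c) :=
          lt_of_le_of_ne hcon (η.injective.ne (u.injective.ne hcd.ne))
        exact (h₂.lt_low d c hcd (hup c hα) hne).not_gt hζ
    · rcases lt_trichotomy c d with hcd | rfl | hcd
      · exact h₁.lt_high c d hcd (hdown c hα) hαβ
      · exact absurd hαβ (lt_irrefl _)
      · by_contra! hcon
        have hne : η (u d) < η (u c) :=
          lt_of_le_of_ne hcon (η.injective.ne (u.injective.ne hcd.ne))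
        exact (h₂.lt_high d c hcd (hdown d hβ) hne).not_gt hζ
  · intro hB
    have hlow : ∀ c ≤ k, u c ≤ η (u c) ∧ η (u c) ≤ ζ (u c) := fun c hc => by
      have h1 : u c ≤ ζ (u c) := h.le_low c hc
      rcases hB.between (u c) with h2 | h2
      · exact h2
      · constructor <;> order
    have hhigh : ∀ c, k < c → ζ (u c) ≤ η (u c) ∧ η (u c) ≤ u c := fun c hc => by
      have h1 : ζ (u c) ≤ u c := h.le_high c hc
      rcases hB.between (u c) with h2 | h2
      · constructor <;> order
      · exact h2
    have hltlow : ∀ c d, c ≤ k → d ≤ k → u c < u d → ζ (u c) < ζ (u d) → η (u c) < η (u d) := by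
      intro c d hc hd hcd hζ
      have h1 := hlow c hc
      have h2 := hlow d hd
      by_cases h3 : u c < ζ (u c)
      · by_cases h4 : u d < ζ (u d)
        · exact hB.lt_up _ _ hcd hζ h3 h4
        · order
      · order
    have hlthigh : ∀ c d, k < c → k < d → u c < u d → ζ (u c) < ζ (u d) →
        η (u c) < η (u d) := by
      intro c d hc hd hcd hζ
      have h1 := hhigh c hc
      have h2 := hhigh d hd
      by_cases h3 : ζ (u c) < u c
      · by_cases h4 : ζ (u d) < u d
        · exact hB.lt_down _ _ hcd hζ h3 h4
        · order
      · order
    have hswap : ∀ c d, c < d → ¬ u c < u d → u d < u c := fun c d hcd hn =>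
      lt_of_le_of_ne (not_lt.1 hn) (u.injective.ne hcd.ne')
    refine ⟨⟨fun c hc => (hlow c hc).1, fun c hc => (hhigh c hc).2, fun c d hcd hd hlt => ?_,
      fun c d hcd hc hlt => ?_⟩, ⟨fun c hc => (hlow c hc).2, fun c hc => (hhigh c hc).1,
      fun c d hcd hd hlt => ?_, fun c d hcd hc hlt => ?_⟩⟩
    · exact hltlow c d (hcd.le.trans hd) hd hlt (h.lt_low c d hcd hd hlt)
    · exact hlthigh c d hc (hc.trans hcd) hlt (h.lt_high c d hcd hc hlt)
    · by_cases hu : u c < u d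
      · exact h.lt_low c d hcd hd hu
      · by_contra hcon
        exact (hltlow d c hd (hcd.le.trans hd) (hswap c d hcd hu)
          (lt_of_le_of_ne (not_lt.1 hcon) ((ζ * u).injective.ne hcd.ne'))).not_gt hlt
    · by_cases hu : u c < u d
      · exact h.lt_high c d hcd hc hu
      · by_contra hcon
        exact (hlthigh d c (hc.trans hcd) hc (hswap c d hcd hu)
          (lt_of_le_of_ne (not_lt.1 hcon) ((ζ * u).injective.ne hcd.ne'))).not_gt hlt

end Criterion

section Transfer

variable {n : ℕ}

lemma exists_viaEmbedding_eq (p : Fin n ↪ ℕ+) {η : Perm ℕ+}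
    (h : ∀ x, x ∉ Set.range p → η x = x) : ∃ σ : Perm (Fin n), σ.viaEmbedding p = η := by
  have hmem : ∀ i, ∃ j, p j = η (p i) := fun i => by
    by_contra hcon
    have hfix := η.injective (h (η (p i)) hcon)
    exact hcon ⟨i, hfix.symm⟩
  choose f hf using hmem
  have hinj : Function.Injective f := fun i j hij => by
    apply p.injective
    apply η.injective
    rw [← hf, ← hf, hij]
  refine ⟨Equiv.ofBijective f (Finite.injective_iff_bijective.1 hinj), Equiv.ext fun x => ?_⟩
  by_cases hx : x ∈ Set.range p
  · obtain ⟨i, rfl⟩ := hx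
    rw [Perm.viaEmbedding_apply]
    exact hf i
  · rw [Perm.viaEmbedding_apply_of_notMem _ _ _ hx, h x hx]

lemma below_viaEmbedding_iff {α β : Type*} [LinearOrder α] [LinearOrder β] (p : α ↪ β)
    (hp : StrictMono p) (σ τ : Perm α) :
    Below (σ.viaEmbedding p) (τ.viaEmbedding p) ↔ Below σ τ := by
  constructor
  · intro h
    refine ⟨fun i => ?_, fun i j => ?_, fun i j => ?_⟩
    · simpa [Perm.viaEmbedding_apply, hp.le_iff_le] using h.between (p i)
    · simpa [Perm.viaEmbedding_apply, hp.lt_iff_lt] using h.lt_up (p i) (p j)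
    · simpa [Perm.viaEmbedding_apply, hp.lt_iff_lt] using h.lt_down (p i) (p j)
  · intro h
    have hmem : ∀ x, τ.viaEmbedding p x ≠ x → x ∈ Set.range p := fun x hx => by
      by_contra hcon
      exact hx (Perm.viaEmbedding_apply_of_notMem _ _ _ hcon)
    refine ⟨fun x => ?_, fun x y hxy hτ hx hy => ?_, fun x y hxy hτ hx hy => ?_⟩
    · by_cases hx : x ∈ Set.range p
      · obtain ⟨i, rfl⟩ := hx
        simpa [Perm.viaEmbedding_apply, hp.le_iff_le] using h.between i
      · simp [Perm.viaEmbedding_apply_of_notMem _ _ _ hx]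
    · obtain ⟨i, rfl⟩ := hmem x hx.ne'
      obtain ⟨j, rfl⟩ := hmem y hy.ne'
      simp only [Perm.viaEmbedding_apply, hp.lt_iff_lt] at *
      exact h.lt_up i j hxy hτ hx hy
    · obtain ⟨i, rfl⟩ := hmem x hx.ne
      obtain ⟨j, rfl⟩ := hmem y hy.ne
      simp only [Perm.viaEmbedding_apply, hp.lt_iff_lt] at *
      exact h.lt_down i j hxy hτ hx hy

/-- An interval of the `k`-Bruhat order is isomorphic to the set of permutations below the
standardization of its left quotient. -/
lemma exists_equiv_interval {k : ℕ+} {u w : Perm ℕ+} (hu : FinSupp u) (huw : kBruhat k u w)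
    (p : Fin n ↪ ℕ+) (hp : StrictMono p) (τ : Perm (Fin n))
    (hτ : τ.viaEmbedding p = w * u⁻¹) :
    ∃ g : {σ : Perm (Fin n) // Below σ τ} ≃ {v : Perm ℕ+ // kBruhat k u v ∧ kBruhat k v w},
      ∀ σ₁ σ₂, kBruhat k (g σ₁).1 (g σ₂).1 ↔ Below σ₁.1 σ₂.1 := by
  have hfin := finite_inversions hu
  have key : ∀ ζ, kBruhat k u (ζ * u) → ∀ η,
      (kBruhat k u (η * u) ∧ kBruhat k (η * u) (ζ * u)) ↔ Below η ζ := by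
    intro ζ hζ η
    rw [← ((kBruhat_iff_dominates hfin).1 hζ).dominates_and_dominates_iff,
      ← kBruhat_iff_dominates hfin]
    exact and_congr_right fun h => kBruhat_iff_dominates (h.dominates_and_finite hfin).2
  obtain rfl : w = τ.viaEmbedding p * u := by rw [hτ, inv_mul_cancel_right]
  have hmem : ∀ σ : {σ : Perm (Fin n) // Below σ τ}, kBruhat k u (σ.1.viaEmbedding p * u) ∧
      kBruhat k (σ.1.viaEmbedding p * u) (τ.viaEmbedding p * u) := fun σ =>
    (key _ huw _).2 ((below_viaEmbedding_iff p hp _ _).2 σ.2)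
  refine ⟨Equiv.ofBijective (fun σ => ⟨σ.1.viaEmbedding p * u, hmem σ⟩) ⟨fun σ₁ σ₂ h => ?_, ?_⟩,
    fun σ₁ σ₂ => ?_⟩
  · rw [Subtype.mk.injEq, mul_left_inj] at h
    exact Subtype.ext (Perm.viaEmbeddingHom_injective p h)
  · rintro ⟨v, hv⟩
    obtain ⟨η, rfl⟩ : ∃ η, v = η * u := ⟨v * u⁻¹, by rw [inv_mul_cancel_right]⟩
    have hB := (key _ huw η).1 hv
    obtain ⟨σ, rfl⟩ := exists_viaEmbedding_eq p (η := η) fun x hx => by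
      have := hB.between x
      rw [Perm.viaEmbedding_apply_of_notMem _ _ _ hx] at this
      rcases this with h | h <;> order
    exact ⟨⟨σ, (below_viaEmbedding_iff p hp _ _).1 hB⟩, rfl⟩
  · rw [← below_viaEmbedding_iff p hp, ← key _ (hmem σ₂).1]
    exact (and_iff_right (hmem σ₁).1).symm

end Transfer

/-- If `u ≤_k w`, `x ≤_l z` and `w u⁻¹` is shape equivalent to `z x⁻¹`, then the
intervals `[u,w]_k` and `[x,z]_l` are isomorphic as posets. -/
theorem stmt_6 (k l : ℕ+) (u w x z : Equiv.Perm ℕ+)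
    (hu : FinSupp u) (hw : FinSupp w) (hx : FinSupp x) (hz : FinSupp z)
    (huw : kBruhat k u w) (hxz : kBruhat l x z)
    (h : ShapeEquiv (w * u⁻¹) (z * x⁻¹)) :
    ∃ f : {v : Equiv.Perm ℕ+ // kBruhat k u v ∧ kBruhat k v w} ≃
          {v : Equiv.Perm ℕ+ // kBruhat l x v ∧ kBruhat l v z},
      ∀ v₁ v₂, kBruhat k v₁.1 v₂.1 ↔ kBruhat l (f v₁).1 (f v₂).1 := by
  obtain ⟨n, p, q, hp, hq, hζ, hη, hpq⟩ := h
  obtain ⟨τ, hτ⟩ := exists_viaEmbedding_eq ⟨p, hp.injective⟩ hζ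
  obtain ⟨τ', hτ'⟩ := exists_viaEmbedding_eq ⟨q, hq.injective⟩ hη
  obtain rfl : τ = τ' := by
    ext1 i
    have h₁ := Perm.viaEmbedding_apply τ ⟨p, hp.injective⟩ i
    have h₂ := Perm.viaEmbedding_apply τ' ⟨q, hq.injective⟩ i
    rw [hτ] at h₁
    rw [hτ'] at h₂
    exact hq.injective (((hpq i (τ i)).1 h₁).symm.trans h₂)
  obtain ⟨g, hg⟩ := exists_equiv_interval hu huw ⟨p, hp.injective⟩ hp τ hτ
  obtain ⟨g', hg'⟩ := exists_equiv_interval hx hxz ⟨q, hq.injective⟩ hq τ hτ'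
  refine ⟨g.symm.trans g', fun v₁ v₂ => ?_⟩
  simp only [Equiv.trans_apply, hg', ← hg, Equiv.apply_symm_apply]
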